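/- arXiv:2307.05952 — 3 statements merged into one kernel-verified Lean document; each statement's English description precedes it below -/
import Mathlib

section
/- Let X = (X₁, …, X_p) be a random vector in ℝ^p whose coordinates (X_j)_{1≤j≤p} are uniformly sub-Gaussian with constants K > 0 and τ₀ > 0, and set Σ_{kl} = E[X_k X_l]. Then for every integer m ≥ 1 and all indices 1 ≤ k, l ≤ p: E[|X_k X_l − Σ_{kl}|^m] ≤ 2^m · m! · τ₀² · K^{2(m−1)}. -/
open MeasureTheory

theorem Real.pow_le_factorial_mul_exp_sub_one {x : ℝ} (hx : 0 ≤ x) {m : ℕ} (hm : 1 ≤ m) :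
    x ^ m ≤ m.factorial * (Real.exp x - 1) := by
  have hfac : (0 : ℝ) < m.factorial := by exact_mod_cast m.factorial_pos
  have hsum := Real.sum_le_exp_of_nonneg hx (m + 1)
  rw [Finset.sum_range_succ] at hsum
  have hone : (1 : ℝ) ≤ ∑ i ∈ Finset.range m, x ^ i / i.factorial := by
    have h := Finset.single_le_sum (f := fun i : ℕ => x ^ i / (i.factorial : ℝ))
      (fun i _ => by positivity) (Finset.mem_range.2 hm)
    simpa using h
  have hdiv : x ^ m / m.factorial ≤ Real.exp x - 1 := by linarith
  rwa [div_le_iff₀' hfac] at hdiv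

theorem abs_mul_pow_le_exp_sq_sub_one (a b : ℝ) {K : ℝ} (hK : 0 < K) {m : ℕ} (hm : 1 ≤ m) :
    |a * b| ^ m ≤ K ^ (2 * m) * m.factorial / 2 *
      ((Real.exp (a ^ 2 / K ^ 2) - 1) + (Real.exp (b ^ 2 / K ^ 2) - 1)) := by
  have hpow (c : ℝ) :
      (|c| ^ m) ^ 2 ≤ K ^ (2 * m) * (m.factorial * (Real.exp (c ^ 2 / K ^ 2) - 1)) := by
    have h := Real.pow_le_factorial_mul_exp_sub_one (x := c ^ 2 / K ^ 2) (by positivity) hm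
    calc (|c| ^ m) ^ 2 = K ^ (2 * m) * (c ^ 2 / K ^ 2) ^ m := by
          rw [div_pow, ← pow_mul K, mul_div_cancel₀ _ (by positivity), ← sq_abs c,
            ← pow_mul, ← pow_mul, mul_comm]
      _ ≤ _ := by gcongr
  rw [abs_mul, mul_pow]
  linarith [two_mul_le_add_sq (|a| ^ m) (|b| ^ m), hpow a, hpow b]

theorem integral_abs_sub_integral_pow_le {Ω : Type*} [MeasurableSpace Ω] {μ : Measure Ω}
    [IsProbabilityMeasure μ] {Z : Ω → ℝ} (hZ : Integrable Z μ) {m : ℕ} (hm : 1 ≤ m)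
    (hZm : Integrable (fun ω => |Z ω| ^ m) μ) :
    ∫ ω, |Z ω - ∫ ω', Z ω' ∂μ| ^ m ∂μ ≤ 2 ^ m * ∫ ω, |Z ω| ^ m ∂μ := by
  set c := ∫ ω', Z ω' ∂μ
  have hc : |c| ^ m ≤ ∫ ω, |Z ω| ^ m ∂μ :=
    calc |c| ^ m ≤ (∫ ω, |Z ω| ∂μ) ^ m := by
          gcongr
          exact abs_integral_le_integral_abs
      _ ≤ _ := (convexOn_pow m).map_integral_le (continuous_pow m).continuousOn isClosed_Ici
          (.of_forall fun ω => abs_nonneg (Z ω)) hZ.abs hZm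
  have hpt (ω : Ω) : |Z ω - c| ^ m ≤ 2 ^ (m - 1) * (|Z ω| ^ m + |c| ^ m) :=
    (pow_le_pow_left₀ (abs_nonneg _) (abs_sub _ _) m).trans
      (add_pow_le (abs_nonneg _) (abs_nonneg _) m)
  calc ∫ ω, |Z ω - c| ^ m ∂μ ≤ ∫ ω, 2 ^ (m - 1) * (|Z ω| ^ m + |c| ^ m) ∂μ :=
        integral_mono_of_nonneg (.of_forall fun ω => by positivity)
          ((hZm.add (integrable_const _)).const_mul _) (.of_forall hpt)
    _ = 2 ^ (m - 1) * (∫ ω, |Z ω| ^ m ∂μ + |c| ^ m) := by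
        rw [integral_const_mul, integral_add hZm (integrable_const _)]
        simp
    _ ≤ 2 ^ (m - 1) * (∫ ω, |Z ω| ^ m ∂μ + ∫ ω, |Z ω| ^ m ∂μ) := by gcongr
    _ = 2 ^ m * ∫ ω, |Z ω| ^ m ∂μ := by
        obtain ⟨n, rfl⟩ := Nat.exists_eq_add_of_le' hm
        rw [Nat.add_sub_cancel, pow_succ]
        ring

/-- Let `X = (X₁, …, X_p)` be a random vector in `ℝ^p` whose coordinates are uniformly
sub-Gaussian with constants `K > 0` and `τ₀ > 0`, i.e. `K²(E[exp(X_j²/K²)] − 1) ≤ τ₀²`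
for every `j`, and set `Σ_{kl} = E[X_k X_l]`.  Then for every integer `m ≥ 1` and all
indices `k, l`:  `E[|X_k X_l − Σ_{kl}|^m] ≤ 2^m · m! · τ₀² · K^{2(m−1)}`. -/
theorem subgaussian_product_moment_bound {Ω : Type*} [MeasurableSpace Ω] (μ : Measure Ω)
    [IsProbabilityMeasure μ] (p : ℕ) (X : Ω → Fin p → ℝ) (hX : Measurable X)
    (K τ₀ : ℝ) (hK : 0 < K) (hτ : 0 < τ₀)
    (hint : ∀ j, Integrable (fun ω => Real.exp ((X ω j) ^ 2 / K ^ 2)) μ)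
    (hsub : ∀ j, K ^ 2 * ((∫ ω, Real.exp ((X ω j) ^ 2 / K ^ 2) ∂μ) - 1) ≤ τ₀ ^ 2)
    (m : ℕ) (hm : 1 ≤ m) (k l : Fin p) :
    ∫ ω, |X ω k * X ω l - ∫ ω', X ω' k * X ω' l ∂μ| ^ m ∂μ ≤
      2 ^ m * (m.factorial : ℝ) * τ₀ ^ 2 * K ^ (2 * (m - 1)) := by
  have hmeas (j : Fin p) : Measurable fun ω => X ω j := (measurable_pi_apply j).comp hX
  have hprod : Measurable fun ω => X ω k * X ω l := (hmeas k).mul (hmeas l)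
  have hexp (j : Fin p) : Integrable (fun ω => Real.exp ((X ω j) ^ 2 / K ^ 2) - 1) μ :=
    (hint j).sub (integrable_const _)
  have hdom (n : ℕ) : Integrable (fun ω => K ^ (2 * n) * n.factorial / 2 *
      ((Real.exp ((X ω k) ^ 2 / K ^ 2) - 1) + (Real.exp ((X ω l) ^ 2 / K ^ 2) - 1))) μ :=
    ((hexp k).add (hexp l)).const_mul _
  have hpow (n : ℕ) (hn : 1 ≤ n) : Integrable (fun ω => |X ω k * X ω l| ^ n) μ := by
    refine (hdom n).mono' (hprod.abs.pow_const n).aestronglyMeasurable (.of_forall fun ω => ?_)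
    rw [Real.norm_of_nonneg (by positivity)]
    exact abs_mul_pow_le_exp_sq_sub_one _ _ hK hn
  have hZ : Integrable (fun ω => X ω k * X ω l) μ := by
    refine (integrable_norm_iff hprod.aestronglyMeasurable).1 ?_
    simpa using hpow 1 le_rfl
  have hsub' (j : Fin p) : K ^ 2 * ∫ ω, (Real.exp ((X ω j) ^ 2 / K ^ 2) - 1) ∂μ ≤ τ₀ ^ 2 := by
    rw [integral_sub (hint j) (integrable_const _)]
    simpa using hsub j
  have hmoment : ∫ ω, |X ω k * X ω l| ^ m ∂μ ≤ m.factorial * τ₀ ^ 2 * K ^ (2 * (m - 1)) :=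
    calc ∫ ω, |X ω k * X ω l| ^ m ∂μ
        ≤ ∫ ω, K ^ (2 * m) * m.factorial / 2 *
            ((Real.exp ((X ω k) ^ 2 / K ^ 2) - 1) + (Real.exp ((X ω l) ^ 2 / K ^ 2) - 1)) ∂μ :=
          integral_mono (hpow m hm) (hdom m) fun ω => abs_mul_pow_le_exp_sq_sub_one _ _ hK hm
      _ = K ^ (2 * (m - 1)) * m.factorial / 2 *
            (K ^ 2 * ∫ ω, (Real.exp ((X ω k) ^ 2 / K ^ 2) - 1) ∂μ +
              K ^ 2 * ∫ ω, (Real.exp ((X ω l) ^ 2 / K ^ 2) - 1) ∂μ) := by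
          rw [integral_const_mul, integral_add (hexp k) (hexp l)]
          obtain ⟨n, rfl⟩ := Nat.exists_eq_add_of_le' hm
          rw [Nat.add_sub_cancel, mul_add 2 n 1, pow_add]
          ring
      _ ≤ K ^ (2 * (m - 1)) * m.factorial / 2 * (τ₀ ^ 2 + τ₀ ^ 2) := by
          gcongr
          exacts [hsub' k, hsub' l]
      _ = m.factorial * τ₀ ^ 2 * K ^ (2 * (m - 1)) := by ring
  calc ∫ ω, |X ω k * X ω l - ∫ ω', X ω' k * X ω' l ∂μ| ^ m ∂μ
      ≤ 2 ^ m * ∫ ω, |X ω k * X ω l| ^ m ∂μ := integral_abs_sub_integral_pow_le hZ hm (hpow m hm)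
    _ ≤ 2 ^ m * (m.factorial * τ₀ ^ 2 * K ^ (2 * (m - 1))) := by gcongr
    _ = 2 ^ m * (m.factorial : ℝ) * τ₀ ^ 2 * K ^ (2 * (m - 1)) := by ring
end

section
/- Let a > 2 and let q(x, γ) = γ·(1{x ≤ γ} + ((aγ − x)₊ / ((a−1)γ))·1{x > γ}) for x ≥ 0 and γ > 0 be the first derivative of the SCAD penalty. If (γ_n) is a sequence of positive reals with γ_n → 0 and √n · γ_n → ∞, then: (i) for every ε > 0, √n · sup_{x ≥ ε} q(x, γ_n) → 0 as n → ∞; and (ii) for every M > 0, √n · inf_{0 ≤ x ≤ M/√n} q(x, γ_n) → ∞ as n → ∞. -/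
open Filter

/-- First derivative of the SCAD penalty:
`q(x, γ) = γ·(1{x ≤ γ} + ((aγ − x)₊ / ((a−1)γ))·1{x > γ})`. -/
noncomputable def scadDeriv (a x γ : ℝ) : ℝ :=
  γ * (if x ≤ γ then 1 else max (a * γ - x) 0 / ((a - 1) * γ))

theorem scadDeriv_of_le {a x γ : ℝ} (h : x ≤ γ) : scadDeriv a x γ = γ := by
  simp [scadDeriv, h]

theorem scadDeriv_eq_zero {a x γ : ℝ} (h : γ < x) (h' : a * γ ≤ x) : scadDeriv a x γ = 0 := by
  rw [scadDeriv, if_neg h.not_ge, max_eq_right (sub_nonpos.2 h'), zero_div, mul_zero]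

/-- Let `a > 2` and let `q` be the SCAD derivative.  If `γ_n → 0` and `√n γ_n → ∞` with
`γ_n > 0`, then (i) for every `ε > 0`, `√n · sup_{x ≥ ε} q(x, γ_n) → 0`, and
(ii) for every `M > 0`, `√n · inf_{0 ≤ x ≤ M/√n} q(x, γ_n) → ∞`. -/
theorem scad_deriv_asymptotics (a : ℝ) (ha : 2 < a) (γ : ℕ → ℝ) (hγpos : ∀ n, 0 < γ n)
    (hγ0 : Tendsto γ atTop (nhds 0))
    (hγtop : Tendsto (fun n : ℕ => Real.sqrt n * γ n) atTop atTop) :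
    (∀ ε > (0 : ℝ), Tendsto
        (fun n : ℕ => Real.sqrt n * ⨆ x : Set.Ici ε, scadDeriv a x.1 (γ n))
        atTop (nhds 0)) ∧
      (∀ M > (0 : ℝ), Tendsto
        (fun n : ℕ => Real.sqrt n * ⨅ x : Set.Icc (0 : ℝ) (M / Real.sqrt n),
          scadDeriv a x.1 (γ n))
        atTop atTop) := by
  refine ⟨fun ε hε => ?_, fun M hM => ?_⟩
  · have haγ : Tendsto (fun n => a * γ n) atTop (nhds 0) := by
      simpa using hγ0.const_mul a
    refine tendsto_const_nhds.congr' ?_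
    filter_upwards [haγ.eventually_lt_const hε] with n hn
    have hzero : ∀ x : Set.Ici ε, scadDeriv a x.1 (γ n) = 0 := fun x => by
      have hx : ε ≤ x.1 := x.2
      exact scadDeriv_eq_zero (by nlinarith [hγpos n]) (by linarith)
    simp [hzero]
  · refine hγtop.congr' ?_
    filter_upwards [hγtop.eventually_ge_atTop M] with n hn
    have hpos : 0 < Real.sqrt n := pos_of_mul_pos_left (hM.trans_le hn) (hγpos n).le
    have hconst : ∀ x : Set.Icc (0 : ℝ) (M / Real.sqrt n), scadDeriv a x.1 (γ n) = γ n :=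
      fun x => scadDeriv_of_le (x.2.2.trans ((div_le_iff₀' hpos).2 hn))
    have : Nonempty (Set.Icc (0 : ℝ) (M / Real.sqrt n)) :=
      ⟨⟨0, le_rfl, (div_pos hM hpos).le⟩⟩
    simp [hconst]
end

section
/- Let Λ ∈ ℝ^{p×m} with rows λ₁, …, λ_p ∈ ℝ^m, Ψ ∈ ℝ^{p×p}, and let F₁, …, F_n ∈ ℝ^m and ε₁, …, ε_n ∈ ℝ^p. Set X_i = Λ F_i + ε_i for i = 1, …, n, Σ* = ΛΛᵀ + Ψ, and Ŝ = (1/n) Σ_{i=1}^n X_i X_iᵀ. Then ‖Ŝ − Σ*‖_max ≤ 2·(max_{1≤k≤p} ‖λ_k‖₂)·√m·max_{1≤k≤m, 1≤l≤p} |(1/n) Σ_{i=1}^n F_{i,k} ε_{i,l}| + ‖(1/n) Σ_{i=1}^n ε_i ε_iᵀ − Ψ‖_max + m² ‖Λ‖_max² ‖(1/n) Σ_{i=1}^n F_i F_iᵀ − I_m‖_max. -/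
open Matrix

/-- The entrywise maximum norm `‖A‖_max = max_{i,j} |A_{i,j}|` of a real matrix. -/
noncomputable def maxNorm {m n : Type*} [Fintype m] [Fintype n] (A : Matrix m n ℝ) : ℝ :=
  ⨆ i, ⨆ j, |A i j|

theorem abs_apply_le_maxNorm {m n : Type*} [Fintype m] [Fintype n] (A : Matrix m n ℝ)
    (i : m) (j : n) : |A i j| ≤ maxNorm A :=
  (le_ciSup (f := fun j => |A i j|) (Set.finite_range _).bddAbove j).trans
    (le_ciSup (f := fun i => ⨆ j, |A i j|) (Set.finite_range _).bddAbove i)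

theorem maxNorm_nonneg {m n : Type*} [Fintype m] [Fintype n] (A : Matrix m n ℝ) :
    0 ≤ maxNorm A :=
  Real.iSup_nonneg fun _ => Real.iSup_nonneg fun _ => abs_nonneg _

theorem maxNorm_le {m n : Type*} [Fintype m] [Fintype n] {A : Matrix m n ℝ} {c : ℝ}
    (hc : 0 ≤ c) (h : ∀ i j, |A i j| ≤ c) : maxNorm A ≤ c :=
  Real.iSup_le (fun i => Real.iSup_le (h i) hc) hc

/-- An entry of a product is controlled by the Euclidean norms of the rows of the left factor. -/
theorem abs_mul_apply_le_iSup_sqrt {p m q : Type*} [Fintype p] [Fintype m] [Fintype q]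
    (A : Matrix p m ℝ) (C : Matrix m q ℝ) (a : p) (b : q) :
    |(A * C) a b| ≤
      (⨆ k, Real.sqrt (∑ j, A k j ^ 2)) * Real.sqrt (Fintype.card m) * maxNorm C := by
  have hrow : ∑ k, |A a k| ≤ Real.sqrt (∑ j, A a j ^ 2) * Real.sqrt (Fintype.card m) := by
    simpa using Real.sum_mul_le_sqrt_mul_sqrt Finset.univ (fun k => |A a k|) (fun _ => 1)
  have hsup : Real.sqrt (∑ j, A a j ^ 2) ≤ ⨆ k, Real.sqrt (∑ j, A k j ^ 2) :=
    le_ciSup (f := fun k => Real.sqrt (∑ j, A k j ^ 2)) (Set.finite_range _).bddAbove a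
  have hC := maxNorm_nonneg C
  calc |(A * C) a b| ≤ ∑ k, |A a k * C k b| := by
        rw [Matrix.mul_apply]; exact Finset.abs_sum_le_sum_abs _ _
    _ ≤ ∑ k, |A a k| * maxNorm C := by
        gcongr with k
        rw [abs_mul]
        gcongr
        exact abs_apply_le_maxNorm C k b
    _ = (∑ k, |A a k|) * maxNorm C := by rw [Finset.sum_mul]
    _ ≤ _ := by
        gcongr
        exact hrow.trans (by gcongr)

theorem maxNorm_mul_le {p m q : Type*} [Fintype p] [Fintype m] [Fintype q]
    (A : Matrix p m ℝ) (B : Matrix m q ℝ) :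
    maxNorm (A * B) ≤ Fintype.card m * (maxNorm A * maxNorm B) := by
  have hA := maxNorm_nonneg A
  have hB := maxNorm_nonneg B
  refine maxNorm_le (by positivity) fun i j => ?_
  calc |(A * B) i j| ≤ ∑ k, |A i k * B k j| := by
        rw [Matrix.mul_apply]; exact Finset.abs_sum_le_sum_abs _ _
    _ ≤ ∑ _k : m, maxNorm A * maxNorm B := by
        gcongr with k
        rw [abs_mul]
        gcongr
        · exact abs_apply_le_maxNorm A i k
        · exact abs_apply_le_maxNorm B k j
    _ = _ := by simp

theorem maxNorm_transpose_le {m n : Type*} [Fintype m] [Fintype n] (A : Matrix m n ℝ) :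
    maxNorm Aᵀ ≤ maxNorm A :=
  maxNorm_le (maxNorm_nonneg A) fun i j => abs_apply_le_maxNorm A j i

/-- Expansion of the sample covariance of a factor model around its population counterpart. -/
theorem sample_cov_sub_eq {ι p m : Type*} [Fintype ι] [Fintype m] [DecidableEq m]
    (c : ℝ) (Λ : Matrix p m ℝ) (Ψ : Matrix p p ℝ) (F : ι → m → ℝ) (ε : ι → p → ℝ) :
    (c • ∑ i, vecMulVec (Λ.mulVec (F i) + ε i) (Λ.mulVec (F i) + ε i)) - (Λ * Λᵀ + Ψ) =
      Λ * (c • ∑ i, vecMulVec (F i) (ε i)) + (Λ * (c • ∑ i, vecMulVec (F i) (ε i)))ᵀ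
        + ((c • ∑ i, vecMulVec (ε i) (ε i)) - Ψ)
        + Λ * ((c • ∑ i, vecMulVec (F i) (F i)) - 1) * Λᵀ := by
  have h : ∀ i, vecMulVec (Λ.mulVec (F i) + ε i) (Λ.mulVec (F i) + ε i) =
      Λ * vecMulVec (F i) (ε i) + (Λ * vecMulVec (F i) (ε i))ᵀ + vecMulVec (ε i) (ε i)
        + Λ * vecMulVec (F i) (F i) * Λᵀ := by
    intro i
    simp only [vecMulVec_add, add_vecMulVec, mul_vecMulVec, vecMulVec_mul, vecMul_transpose,
      transpose_vecMulVec]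
    abel
  simp only [h, Finset.sum_add_distrib,
    ← transpose_sum, Matrix.mul_sub, Matrix.sub_mul, Matrix.mul_smul, Matrix.smul_mul,
    transpose_smul, smul_add, Matrix.mul_one, ← Matrix.mul_sum, ← Matrix.sum_mul]
  abel

/-- Let `Λ ∈ ℝ^{p×m}` with rows `λ₁, …, λ_p`, `Ψ ∈ ℝ^{p×p}`, `F₁, …, F_n ∈ ℝ^m`,
`ε₁, …, ε_n ∈ ℝ^p`, and set `Xᵢ = Λ Fᵢ + εᵢ`, `Σ* = ΛΛᵀ + Ψ`, `Ŝ = (1/n) ∑ᵢ XᵢXᵢᵀ`.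
Then `‖Ŝ − Σ*‖_max ≤ 2 (max_k ‖λ_k‖₂) √m max_{k,l} |(1/n)∑ᵢ F_{i,k} ε_{i,l}|
  + ‖(1/n)∑ᵢ εᵢεᵢᵀ − Ψ‖_max + m² ‖Λ‖_max² ‖(1/n)∑ᵢ FᵢFᵢᵀ − I_m‖_max`. -/
theorem sample_cov_factor_max_bound (n p m : ℕ) (hn : 0 < n)
    (Λ : Matrix (Fin p) (Fin m) ℝ) (Ψ : Matrix (Fin p) (Fin p) ℝ)
    (F : Fin n → Fin m → ℝ) (ε : Fin n → Fin p → ℝ) :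
    maxNorm (((n : ℝ)⁻¹ • ∑ i, vecMulVec (Λ.mulVec (F i) + ε i) (Λ.mulVec (F i) + ε i))
        - (Λ * Λᵀ + Ψ)) ≤
      2 * (⨆ k : Fin p, Real.sqrt (∑ j, (Λ k j) ^ 2)) * Real.sqrt m *
          (⨆ k : Fin m, ⨆ l : Fin p, |(n : ℝ)⁻¹ * ∑ i, F i k * ε i l|)
        + maxNorm (((n : ℝ)⁻¹ • ∑ i, vecMulVec (ε i) (ε i)) - Ψ)
        + (m : ℝ) ^ 2 * maxNorm Λ ^ 2 *
            maxNorm (((n : ℝ)⁻¹ • ∑ i, vecMulVec (F i) (F i)) - 1) := by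
  set C : Matrix (Fin m) (Fin p) ℝ := (n : ℝ)⁻¹ • ∑ i, vecMulVec (F i) (ε i) with hC
  have hCmax : (⨆ k : Fin m, ⨆ l : Fin p, |(n : ℝ)⁻¹ * ∑ i, F i k * ε i l|) = maxNorm C := by
    simp [maxNorm, hC, Matrix.sum_apply, vecMulVec_apply]
  rw [sample_cov_sub_eq, hCmax, ← hC]
  set E := ((n : ℝ)⁻¹ • ∑ i, vecMulVec (ε i) (ε i)) - Ψ
  set D := ((n : ℝ)⁻¹ • ∑ i, vecMulVec (F i) (F i)) - 1
  have hΛ0 := maxNorm_nonneg Λ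
  have hC0 := maxNorm_nonneg C
  have hE0 := maxNorm_nonneg E
  have hD0 := maxNorm_nonneg D
  have hsup0 : 0 ≤ ⨆ k : Fin p, Real.sqrt (∑ j, (Λ k j) ^ 2) :=
    Real.iSup_nonneg fun _ => Real.sqrt_nonneg _
  have hquad : maxNorm (Λ * D * Λᵀ) ≤ (m : ℝ) ^ 2 * maxNorm Λ ^ 2 * maxNorm D := by
    calc maxNorm (Λ * D * Λᵀ) ≤ m * (maxNorm (Λ * D) * maxNorm Λᵀ) := by
          simpa using maxNorm_mul_le (Λ * D) Λᵀ
      _ ≤ m * (m * (maxNorm Λ * maxNorm D) * maxNorm Λ) := by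
          gcongr
          · exact maxNorm_nonneg _
          · simpa using maxNorm_mul_le Λ D
          · exact maxNorm_transpose_le Λ
      _ = _ := by ring
  refine maxNorm_le (by positivity) fun a b => ?_
  have h₁ := abs_mul_apply_le_iSup_sqrt Λ C a b
  have h₂ := abs_mul_apply_le_iSup_sqrt Λ C b a
  rw [Fintype.card_fin] at h₁ h₂
  have h₃ := abs_apply_le_maxNorm E a b
  have h₄ := (abs_apply_le_maxNorm (Λ * D * Λᵀ) a b).trans hquad
  simp only [Matrix.add_apply, transpose_apply]
  have h₅ := abs_add_le ((Λ * C) a b + (Λ * C) b a + E a b) ((Λ * D * Λᵀ) a b)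
  have h₆ := abs_add_three ((Λ * C) a b) ((Λ * C) b a) (E a b)
  linarith
end
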